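/- arXiv:1006.2794 — 6 statements merged into one kernel-verified Lean document; each statement's English description precedes it below -/
import Mathlib

section
/- Let U be a unitary operator on ℂ²⊗ℂ² such that for every unit vector ψ ∈ ℂ² there exists a complex number c_ψ of modulus 1 with U(ψ⊗ψ) = c_ψ·(ψ⊗ψ). Then there exist real numbers γ and η such that U = e^{iγ}(cos η · I + i sin η · S), where S is the swap operator. -/
open Matrix Complex BigOperators

noncomputable section

/-- The swap operator `S` on `ℂ^d ⊗ ℂ^d`, determined by `S(x ⊗ y) = y ⊗ x`. -/
def swapOp (d : ℕ) : Matrix (Fin d × Fin d) (Fin d × Fin d) ℂ :=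
  Matrix.of fun p q => if p.1 = q.2 ∧ p.2 = q.1 then 1 else 0

/-- Tensor product of two vectors. -/
def vecTensor {d m : ℕ} (ψ : Fin d → ℂ) (χ : Fin m → ℂ) : Fin d × Fin m → ℂ :=
  fun p => ψ p.1 * χ p.2

/-- If a unitary `U` on `ℂ² ⊗ ℂ²` fixes every vector `ψ ⊗ ψ` (ψ a unit vector) up to a
phase, then `U = e^{iγ}(cos η · I + i sin η · S)` for some real `γ, η`. -/
theorem stmt0 (U : Matrix (Fin 2 × Fin 2) (Fin 2 × Fin 2) ℂ)
    (hU : U ∈ Matrix.unitaryGroup (Fin 2 × Fin 2) ℂ)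
    (h : ∀ ψ : Fin 2 → ℂ, (∑ i, ‖ψ i‖ ^ 2) = 1 →
      ∃ c : ℂ, ‖c‖ = 1 ∧ U.mulVec (vecTensor ψ ψ) = c • vecTensor ψ ψ) :
    ∃ γ η : ℝ, U = Complex.exp (Complex.I * γ) •
      ((Real.cos η : ℂ) • (1 : Matrix (Fin 2 × Fin 2) (Fin 2 × Fin 2) ℂ)
        + (Complex.I * (Real.sin η : ℂ)) • swapOp 2) := by
  have e0 := h ![1, 0] (by simp)
  have e1 := h ![0, 1] (by simp)
  have f0 := h ![3/5, 4/5] (by simp [Fin.sum_univ_two]; norm_num)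
  have f1 := h ![3/5, -4/5] (by simp [Fin.sum_univ_two]; norm_num)
  clear h
  obtain ⟨a, ha, e0⟩ := e0
  obtain ⟨b, hb, e1⟩ := e1
  obtain ⟨c, hc, f0⟩ := f0
  obtain ⟨c', hc', f1⟩ := f1
  have hUU := (Matrix.mem_unitaryGroup_iff'.mp hU)
  have key : ∀ (c : ℂ) (s t : ℂ), U.mulVec (vecTensor ![s, t] ![s, t]) = c • vecTensor ![s, t] ![s, t] →
      ∀ i j, U (i, j) (0, 0) * (s * s) + U (i, j) (0, 1) * (s * t) + U (i, j) (1, 0) * (t * s)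
        + U (i, j) (1, 1) * (t * t) = c * (![s, t] i * ![s, t] j) := by
    intro c s t hh i j
    have := congrFun hh (i, j)
    simp only [Matrix.mulVec, dotProduct, vecTensor, Fintype.sum_prod_type, Fin.sum_univ_two,
      Pi.smul_apply, smul_eq_mul] at this
    rw [← this]
    simp
    ring
  have orth : ∀ p q, star (U (0, 0) p) * U (0, 0) q + star (U (0, 1) p) * U (0, 1) q
      + star (U (1, 0) p) * U (1, 0) q + star (U (1, 1) p) * U (1, 1) q
      = if p = q then 1 else 0 := by
    intro p q
    have := congrFun (congrFun hUU p) q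
    simp only [Matrix.mul_apply, Matrix.star_apply, Fintype.sum_prod_type, Fin.sum_univ_two,
      Matrix.one_apply] at this
    rw [← this]
    ring
  have E0 := key _ _ _ e0
  have E1 := key _ _ _ e1
  have F0 := key _ _ _ f0
  have F1 := key _ _ _ f1
  have a00 := E0 0 0
  have a01 := E0 0 1
  have a10 := E0 1 0
  have a11 := E0 1 1
  have b00 := E1 0 0
  have b01 := E1 0 1
  have b10 := E1 1 0
  have b11 := E1 1 1
  have c00 := F0 0 0
  have c01 := F0 0 1
  have c10 := F0 1 0
  have c11 := F0 1 1
  have d00 := F1 0 0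
  have d01 := F1 0 1
  have d10 := F1 1 0
  have d11 := F1 1 1
  clear E0 E1 F0 F1 e0 e1 f0 f1 key
  simp at a00 a01 a10 a11 b00 b01 b10 b11
  simp only [Matrix.cons_val_zero, Matrix.cons_val_one, a00, a01, a10, a11, b00, b01, b10, b11]
    at c00 c01 c10 c11 d00 d01 d10 d11
  have hcc : c' = c := by linear_combination (25/12) * (d01 + c01)
  subst hcc
  have hac : a = c' := by linear_combination (25/18) * (c00 + d00)
  have hbc : b = c' := by linear_combination (25/32) * (c11 + d11)
  subst hac
  subst hbc
  have w0 : U (0, 0) (1, 0) = - U (0, 0) (0, 1) := by linear_combination (25/12) * c00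
  have w1 : U (0, 1) (1, 0) = b - U (0, 1) (0, 1) := by linear_combination (25/12) * c01
  have w2 : U (1, 0) (1, 0) = b - U (1, 0) (0, 1) := by linear_combination (25/12) * c10
  have w3 : U (1, 1) (1, 0) = - U (1, 1) (0, 1) := by linear_combination (25/12) * c11
  have hb0 : b ≠ 0 := by
    intro h0
    simp [h0] at hb
  have o1 := orth (0, 0) (0, 1)
  have o2 := orth (1, 1) (0, 1)
  have o3 := orth (0, 1) (0, 1)
  have o4 := orth (0, 1) (1, 0)
  simp [a00, a01, a10, a11, hb0] at o1
  simp [b00, b01, b10, b11, hb0] at o2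
  simp [o1, o2] at o3
  simp [o1, o2, w0, w1, w2, w3] at o4
  rw [o1] at w0
  rw [o2] at w3
  generalize hp : U (0, 1) (0, 1) = p at *
  generalize hq : U (1, 0) (0, 1) = q at *
  have hbb : (starRingEnd ℂ) b * b = 1 := by
    rw [mul_comm, Complex.mul_conj, Complex.normSq_eq_norm_sq, hb]; simp
  have hpq : (starRingEnd ℂ) (p + q) * b = 1 := by
    rw [map_add]; linear_combination o4 + o3
  have hpqb : p + q = b := by
    have : (starRingEnd ℂ) (p + q) = (starRingEnd ℂ) b :=
      mul_right_cancel₀ hb0 (hpq.trans hbb.symm)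
    exact (starRingEnd ℂ).injective this
  have hd : ‖p - q‖ = 1 := by
    have h1 : (starRingEnd ℂ) (p - q) * (p - q) = 1 := by
      rw [← hpqb, map_add] at hbb
      rw [map_sub]
      linear_combination 2 * o3 - hbb
    rw [mul_comm, Complex.mul_conj, Complex.normSq_eq_norm_sq] at h1
    have h2 : ‖p - q‖ ^ 2 = 1 := by exact_mod_cast h1
    exact (pow_eq_one_iff_of_nonneg (norm_nonneg _) two_ne_zero).mp h2
  obtain ⟨α, hα⟩ := (Complex.norm_eq_one_iff b).mp hb
  obtain ⟨β, hβ⟩ := (Complex.norm_eq_one_iff (p - q)).mp hd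
  have k1 : Complex.exp (Complex.I * ((α + β) / 2 : ℝ)) *
      (Real.cos ((α - β) / 2) + Complex.I * Real.sin ((α - β) / 2)) = b := by
    rw [← hα, Complex.ofReal_cos, Complex.ofReal_sin, mul_comm Complex.I (Complex.sin _),
      ← Complex.exp_mul_I, ← Complex.exp_add]
    congr 1; push_cast; ring
  have k2 : Complex.exp (Complex.I * ((α + β) / 2 : ℝ)) *
      (Real.cos ((α - β) / 2) - Complex.I * Real.sin ((α - β) / 2)) = p - q := by
    rw [← hβ, Complex.ofReal_cos, Complex.ofReal_sin, mul_comm Complex.I (Complex.sin _),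
      ← Complex.cos_neg, sub_eq_add_neg, ← neg_mul, ← Complex.sin_neg,
      ← Complex.exp_mul_I, ← Complex.exp_add]
    congr 1; push_cast; ring
  refine ⟨(α + β) / 2, (α - β) / 2, ?_⟩
  generalize Complex.exp (Complex.I * ((α + β) / 2 : ℝ)) = x at *
  generalize ((Real.cos ((α - β) / 2) : ℝ) : ℂ) = y at *
  generalize ((Real.sin ((α - β) / 2) : ℝ) : ℂ) = z at *
  have r1 : x * y = p := by linear_combination (k1 + k2 - hpqb) / 2
  have r2 : x * (Complex.I * z) = q := by linear_combination (k1 - k2 - hpqb) / 2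
  have r3 : x * (y + Complex.I * z) = b := k1
  ext ⟨i, j⟩ ⟨k, l⟩
  fin_cases i <;> fin_cases j <;> fin_cases k <;> fin_cases l <;>
    simp [swapOp, Matrix.one_apply, *]
  all_goals linear_combination -hpqb
end
end

section
/- Let ρ and ξ be d×d density matrices, η ∈ ℝ, c = cos η, s = sin η, and let U_η = c·I + i s·S be the partial swap on ℂ^d⊗ℂ^d. Then the partial trace over the second factor of U_η(ρ⊗ξ)U_η† equals c²ρ + s²ξ + i c s (ξρ − ρξ), and the partial trace over the first factor equals s²ρ + c²ξ + i c s (ρξ − ξρ). -/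
open Matrix Complex Kronecker BigOperators
open scoped ComplexOrder

noncomputable section

/-- The partial swap `U_η = cos η · I + i sin η · S`. -/
def pswap (d : ℕ) (η : ℝ) : Matrix (Fin d × Fin d) (Fin d × Fin d) ℂ :=
  (Real.cos η : ℂ) • 1 + (Complex.I * (Real.sin η : ℂ)) • swapOp d

/-- Partial trace over the second tensor factor. -/
def ptr2 {a b : Type*} [Fintype a] [Fintype b]
    (M : Matrix (a × b) (a × b) ℂ) : Matrix a a ℂ :=
  Matrix.of fun i j => ∑ k, M (i, k) (j, k)

/-- Partial trace over the first tensor factor. -/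
def ptr1 {a b : Type*} [Fintype a] [Fintype b]
    (M : Matrix (a × b) (a × b) ℂ) : Matrix b b ℂ :=
  Matrix.of fun i j => ∑ k, M (k, i) (k, j)

theorem swap_mul_apply (d : ℕ) (M : Matrix (Fin d × Fin d) (Fin d × Fin d) ℂ)
    (p q : Fin d × Fin d) : (swapOp d * M) p q = M (p.2, p.1) q := by
  rw [Matrix.mul_apply, Finset.sum_eq_single (p.2, p.1)]
  · simp [swapOp]
  · rintro ⟨a, b⟩ _ h
    have : ¬ (p.1 = b ∧ p.2 = a) := fun h' => h (by rw [h'.1, h'.2])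
    simp [swapOp, this]
  · simp

theorem mul_swap_apply (d : ℕ) (M : Matrix (Fin d × Fin d) (Fin d × Fin d) ℂ)
    (p q : Fin d × Fin d) : (M * swapOp d) p q = M p (q.2, q.1) := by
  rw [Matrix.mul_apply, Finset.sum_eq_single (q.2, q.1)]
  · simp [swapOp]
  · rintro ⟨a, b⟩ _ h
    have : ¬ (a = q.2 ∧ b = q.1) := fun h' => h (by rw [h'.1, h'.2])
    simp [swapOp, this]
  · simp

theorem swapOp_conjTranspose (d : ℕ) : (swapOp d)ᴴ = swapOp d := by
  ext p q
  have : (q.1 = p.2 ∧ q.2 = p.1) ↔ (p.1 = q.2 ∧ p.2 = q.1) := by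
    constructor <;> rintro ⟨h, h'⟩ <;> exact ⟨h'.symm, h.symm⟩
  simp only [swapOp, Matrix.conjTranspose_apply, Matrix.of_apply, this]
  split_ifs <;> simp

theorem conj_apply (d : ℕ) (η : ℝ) (M : Matrix (Fin d × Fin d) (Fin d × Fin d) ℂ)
    (p q : Fin d × Fin d) : (pswap d η * M * (pswap d η)ᴴ) p q =
      (Real.cos η : ℂ) ^ 2 * M p q + (Real.sin η : ℂ) ^ 2 * M (p.2, p.1) (q.2, q.1)
      + (Complex.I * (Real.cos η : ℂ) * (Real.sin η : ℂ)) *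
        (M (p.2, p.1) q - M p (q.2, q.1)) := by
  have h : (pswap d η)ᴴ =
      (Real.cos η : ℂ) • 1 + (-(Complex.I * (Real.sin η : ℂ))) • swapOp d := by
    rw [pswap, Matrix.conjTranspose_add, Matrix.conjTranspose_smul, Matrix.conjTranspose_smul,
      swapOp_conjTranspose, Matrix.conjTranspose_one]
    simp only [star_mul', RCLike.star_def, Complex.conj_ofReal, Complex.conj_I, neg_mul]
  rw [h, pswap]
  simp only [Matrix.add_mul, Matrix.mul_add, Matrix.smul_mul, Matrix.mul_smul, Matrix.one_mul,
    Matrix.mul_one, Matrix.add_apply, Matrix.smul_apply, swap_mul_apply, mul_swap_apply,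
    smul_eq_mul]
  linear_combination (-(Real.sin η : ℂ) ^ 2 * M (p.2, p.1) (q.2, q.1)) * Complex.I_sq

/-- For density matrices `ρ, ξ`, the marginals of `U_η (ρ ⊗ ξ) U_η†` are
`c²ρ + s²ξ + ics(ξρ − ρξ)` and `s²ρ + c²ξ + ics(ρξ − ξρ)`. -/
theorem stmt2 {d : ℕ} (ρ ξ : Matrix (Fin d) (Fin d) ℂ)
    (hρ : ρ.PosSemidef) (hρt : ρ.trace = 1)
    (hξ : ξ.PosSemidef) (hξt : ξ.trace = 1) (η : ℝ) :
    ptr2 (pswap d η * (ρ ⊗ₖ ξ) * (pswap d η)ᴴ)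
      = ((Real.cos η : ℂ) ^ 2) • ρ + ((Real.sin η : ℂ) ^ 2) • ξ
        + (Complex.I * (Real.cos η : ℂ) * (Real.sin η : ℂ)) • (ξ * ρ - ρ * ξ) ∧
    ptr1 (pswap d η * (ρ ⊗ₖ ξ) * (pswap d η)ᴴ)
      = ((Real.sin η : ℂ) ^ 2) • ρ + ((Real.cos η : ℂ) ^ 2) • ξ
        + (Complex.I * (Real.cos η : ℂ) * (Real.sin η : ℂ)) • (ρ * ξ - ξ * ρ) := by
  have h1 : ∑ k, ρ k k = 1 := hρt
  have h2 : ∑ k, ξ k k = 1 := hξt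
  constructor
  · ext i j
    simp only [ptr2, Matrix.of_apply, conj_apply]
    simp only [Matrix.kroneckerMap_apply, Matrix.add_apply,
      Matrix.smul_apply, Matrix.sub_apply, Matrix.mul_apply, smul_eq_mul,
      Finset.sum_add_distrib, ← Finset.mul_sum, Finset.sum_sub_distrib, ← Finset.sum_mul, h1, h2]
    simp only [mul_comm, mul_one, one_mul]
  · ext i j
    simp only [ptr1, Matrix.of_apply, conj_apply]
    simp only [Matrix.kroneckerMap_apply, Matrix.add_apply,
      Matrix.smul_apply, Matrix.sub_apply, Matrix.mul_apply, smul_eq_mul,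
      Finset.sum_add_distrib, ← Finset.mul_sum, Finset.sum_sub_distrib, ← Finset.sum_mul, h1, h2]
    simp only [mul_comm, mul_one, one_mul]
    ring
end
end

section
/- Let ξ be a d×d density matrix, η ∈ ℝ, c = cos η, s = sin η, and define the homogenization channel E[ρ] = c²ρ + s²ξ + i c s (ξρ − ρξ). Then for all d×d density matrices ρ₁, ρ₂, writing Δ = ρ₁ − ρ₂, one has the exact identity ‖E[ρ₁] − E[ρ₂]‖² = c⁴‖Δ‖² + c²s²‖ξΔ − Δξ‖², and consequently the contraction estimate ‖E[ρ₁] − E[ρ₂]‖ ≤ |c|·‖ρ₁ − ρ₂‖ in the Hilbert–Schmidt norm. -/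
open Matrix Complex BigOperators
open scoped ComplexOrder

noncomputable section

/-- The Hilbert–Schmidt (Frobenius) norm `‖X‖ = √(tr(X†X))`. -/
def hsNorm {n : Type*} [Fintype n] (X : Matrix n n ℂ) : ℝ :=
  Real.sqrt (Matrix.trace (Xᴴ * X)).re

/-- The homogenization channel `E[ρ] = c²ρ + s²ξ + ics(ξρ − ρξ)`, `c = cos η`,
`s = sin η`. -/
def homogChan {d : ℕ} (ξ : Matrix (Fin d) (Fin d) ℂ) (η : ℝ)
    (ρ : Matrix (Fin d) (Fin d) ℂ) : Matrix (Fin d) (Fin d) ℂ :=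
  ((Real.cos η : ℂ) ^ 2) • ρ + ((Real.sin η : ℂ) ^ 2) • ξ
    + (Complex.I * (Real.cos η : ℂ) * (Real.sin η : ℂ)) • (ξ * ρ - ρ * ξ)

lemma hsNorm_sq {n : Type*} [Fintype n] (X : Matrix n n ℂ) :
    hsNorm X ^ 2 = (Matrix.trace (Xᴴ * X)).re := by
  unfold hsNorm
  rw [Real.sq_sqrt]
  exact (Complex.le_def.1 (Matrix.posSemidef_conjTranspose_mul_self X).trace_nonneg).1

lemma sub_sq_psd {d : ℕ} (ξ : Matrix (Fin d) (Fin d) ℂ)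
    (hξ : ξ.PosSemidef) (hξt : ξ.trace = 1) : (ξ - ξ * ξ).PosSemidef := by
  have hs := hξ.1.spectral_theorem
  have ht := hξ.1.trace_eq_sum_eigenvalues
  rw [hξt] at ht
  have ht' : ∑ i, hξ.1.eigenvalues i = 1 := by
    have := congrArg Complex.re ht
    simpa using this.symm
  have h0 := hξ.eigenvalues_nonneg
  have h1 : ∀ i, hξ.1.eigenvalues i ≤ 1 := fun i => by
    rw [← ht']
    exact Finset.single_le_sum (fun j _ => h0 j) (Finset.mem_univ i)
  set U : Matrix (Fin d) (Fin d) ℂ := (hξ.1.eigenvectorUnitary : Matrix (Fin d) (Fin d) ℂ) with hU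
  set D : Matrix (Fin d) (Fin d) ℂ := diagonal (RCLike.ofReal ∘ hξ.1.eigenvalues) with hD
  have hUU : Uᴴ * U = 1 := by
    rw [← star_eq_conjTranspose]
    exact Unitary.coe_star_mul_self _
  have hs' : ξ = U * D * Uᴴ := by
    rw [← star_eq_conjTranspose]
    rw [Unitary.conjStarAlgAut_apply] at hs
    exact hs
  have : ξ - ξ * ξ = U * (D - D * D) * Uᴴ := by
    have : ξ * ξ = U * (D * D) * Uᴴ := by
      calc ξ * ξ = U * D * (Uᴴ * U) * D * Uᴴ := by rw [hs']; noncomm_ring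
        _ = _ := by rw [hUU]; noncomm_ring
    rw [this, mul_sub, sub_mul, ← hs']
  rw [this]
  apply PosSemidef.mul_mul_conjTranspose_same
  rw [hD, diagonal_mul_diagonal, diagonal_sub]
  apply PosSemidef.diagonal
  intro i
  have h2 : 0 ≤ hξ.1.eigenvalues i - hξ.1.eigenvalues i * hξ.1.eigenvalues i := by
    nlinarith [h0 i, h1 i]
  simpa using (by exact_mod_cast h2 :
    (0:ℂ) ≤ (hξ.1.eigenvalues i : ℂ) - hξ.1.eigenvalues i * hξ.1.eigenvalues i)

lemma comm_bound {d : ℕ} (ξ Δ : Matrix (Fin d) (Fin d) ℂ)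
    (hξ : ξ.PosSemidef) (hξt : ξ.trace = 1) (hΔ : Δᴴ = Δ) :
    hsNorm (ξ * Δ - Δ * ξ) ^ 2 ≤ hsNorm Δ ^ 2 := by
  have hx : ξᴴ = ξ := hξ.1
  have h1 := (Complex.le_def.1
    ((sub_sq_psd ξ hξ hξt).conjTranspose_mul_mul_same Δ).trace_nonneg).1
  have h2 := (Complex.le_def.1
    (Matrix.posSemidef_conjTranspose_mul_self (ξ * Δ + Δ * ξ - Δ)).trace_nonneg).1
  rw [hsNorm_sq, hsNorm_sq]
  simp only [conjTranspose_sub, conjTranspose_add, conjTranspose_mul, hx, hΔ, mul_sub, sub_mul,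
    mul_add, add_mul, trace_sub, trace_add, ← Matrix.mul_assoc, Complex.sub_re, Complex.add_re,
    Complex.zero_re] at h1 h2 ⊢
  have e1 : (ξ * Δ * Δ).trace = (Δ * ξ * Δ).trace := by
    rw [Matrix.mul_assoc Δ, trace_mul_comm Δ]
  have e2 : (Δ * Δ * ξ).trace = (Δ * ξ * Δ).trace := by
    rw [Matrix.mul_assoc Δ, trace_mul_comm Δ]
  have e3 : (ξ * Δ * Δ * ξ).trace = (Δ * ξ * ξ * Δ).trace := by
    rw [Matrix.mul_assoc (ξ * Δ), trace_mul_comm (ξ * Δ), ← Matrix.mul_assoc]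
  have e4 : (ξ * Δ * ξ * Δ).trace = (Δ * ξ * Δ * ξ).trace := by
    rw [Matrix.mul_assoc ξ, Matrix.mul_assoc ξ, trace_mul_comm ξ]
  simp only [e1, e2, e3, e4] at h1 h2 ⊢
  linarith

lemma exact_id {d : ℕ} (ξ Δ : Matrix (Fin d) (Fin d) ℂ) (hx : ξᴴ = ξ) (hΔ : Δᴴ = Δ) (c s : ℝ) :
    hsNorm (((c : ℂ) ^ 2) • Δ + (Complex.I * c * s) • (ξ * Δ - Δ * ξ)) ^ 2
      = c ^ 4 * hsNorm Δ ^ 2 + c ^ 2 * s ^ 2 * hsNorm (ξ * Δ - Δ * ξ) ^ 2 := by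
  simp only [hsNorm_sq]
  set K := ξ * Δ - Δ * ξ with hK
  have hKH : Kᴴ = -K := by
    rw [hK]; simp [conjTranspose_mul, hx, hΔ]
  have hz : (Δ * K).trace = 0 := by
    rw [hK, mul_sub, trace_sub, trace_mul_comm Δ (ξ * Δ), trace_mul_comm Δ (Δ * ξ),
      trace_mul_comm (ξ * Δ) Δ, trace_mul_comm (Δ * ξ) Δ, trace_mul_comm Δ (ξ * Δ),
      Matrix.mul_assoc, trace_mul_comm ξ, Matrix.mul_assoc, sub_self]
  have hz' : (K * Δ).trace = 0 := by rw [trace_mul_comm, hz]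
  have : (((((c : ℂ) ^ 2) • Δ + (Complex.I * c * s) • K)ᴴ *
      (((c : ℂ) ^ 2) • Δ + (Complex.I * c * s) • K))).trace
      = ((c ^ 4 : ℝ) : ℂ) * (Δᴴ * Δ).trace + ((c ^ 2 * s ^ 2 : ℝ) : ℂ) * (Kᴴ * K).trace := by
    simp only [conjTranspose_add, conjTranspose_smul, hKH, hΔ, mul_add, add_mul, smul_mul_assoc,
      mul_smul_comm, trace_add, trace_smul, hz, hz', neg_mul, trace_neg, smul_eq_mul]
    simp
    linear_combination ((c:ℂ)^2 * s^2 * (K * K).trace) * Complex.I_sq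
  rw [this, Complex.add_re, Complex.re_ofReal_mul, Complex.re_ofReal_mul]

/-- Exact identity `‖E[ρ₁] − E[ρ₂]‖² = c⁴‖Δ‖² + c²s²‖ξΔ − Δξ‖²` and the contraction
estimate `‖E[ρ₁] − E[ρ₂]‖ ≤ |c|·‖ρ₁ − ρ₂‖` in Hilbert–Schmidt norm. -/
theorem stmt4 {d : ℕ} (ξ : Matrix (Fin d) (Fin d) ℂ)
    (hξ : ξ.PosSemidef) (hξt : ξ.trace = 1) (η : ℝ)
    (ρ₁ ρ₂ : Matrix (Fin d) (Fin d) ℂ)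
    (hρ₁ : ρ₁.PosSemidef) (hρ₁t : ρ₁.trace = 1)
    (hρ₂ : ρ₂.PosSemidef) (hρ₂t : ρ₂.trace = 1) :
    hsNorm (homogChan ξ η ρ₁ - homogChan ξ η ρ₂) ^ 2
        = (Real.cos η) ^ 4 * hsNorm (ρ₁ - ρ₂) ^ 2
          + (Real.cos η) ^ 2 * (Real.sin η) ^ 2
            * hsNorm (ξ * (ρ₁ - ρ₂) - (ρ₁ - ρ₂) * ξ) ^ 2 ∧
    hsNorm (homogChan ξ η ρ₁ - homogChan ξ η ρ₂) ≤ |Real.cos η| * hsNorm (ρ₁ - ρ₂) := by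
  have hx : ξᴴ = ξ := hξ.1
  have hΔ : (ρ₁ - ρ₂)ᴴ = ρ₁ - ρ₂ := by rw [conjTranspose_sub, hρ₁.1.eq, hρ₂.1.eq]
  have hE : homogChan ξ η ρ₁ - homogChan ξ η ρ₂ = ((Real.cos η : ℂ) ^ 2) • (ρ₁ - ρ₂)
      + (Complex.I * (Real.cos η : ℂ) * (Real.sin η : ℂ)) •
        (ξ * (ρ₁ - ρ₂) - (ρ₁ - ρ₂) * ξ) := by
    unfold homogChan
    simp only [mul_sub, sub_mul, smul_sub]
    abel
  have h1 := exact_id ξ (ρ₁ - ρ₂) hx hΔ (Real.cos η) (Real.sin η)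
  rw [← hE] at h1
  refine ⟨h1, ?_⟩
  have h2 := comm_bound ξ (ρ₁ - ρ₂) hξ hξt hΔ
  have hn : 0 ≤ hsNorm (ρ₁ - ρ₂) := Real.sqrt_nonneg _
  refine (fun h0 h => (abs_le_of_sq_le_sq' h h0).2) (mul_nonneg (abs_nonneg _) hn) ?_
  rw [h1, mul_pow, sq_abs]
  have h3 := mul_le_mul_of_nonneg_left h2
    (mul_nonneg (sq_nonneg (Real.cos η)) (sq_nonneg (Real.sin η)))
  have h4 : Real.sin η ^ 2 = 1 - Real.cos η ^ 2 := Real.sin_sq η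
  rw [h4] at h3 ⊢
  linarith
end
end

section
/- Let {φ_j}_{j=1}^d be an orthonormal basis of ℂ^d and let U = Σ_j |φ_j⟩⟨φ_j| ⊗ V_j be a controlled unitary on ℂ^d⊗ℂ^m with each V_j unitary. Then the following are equivalent: (i) the unitaries V_1,…,V_d pairwise commute; (ii) there exist an orthonormal basis {ψ_k}_{k=1}^m of ℂ^m and unitaries U_1,…,U_m on ℂ^d such that U = Σ_k U_k ⊗ |ψ_k⟩⟨ψ_k|; (iii) there exist an orthonormal basis {ψ_k} of ℂ^m and real phases η_{jk} such that U(φ_j⊗ψ_k) = e^{iη_{jk}} φ_j⊗ψ_k for all j,k. In this situation the collision U generates decoherence simultaneously on both interacting systems, in the bases {φ_j} and {ψ_k}. -/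
open Matrix Complex Kronecker BigOperators

noncomputable section

/-- The rank-one projector `|ψ⟩⟨ψ|`. -/
def outer {d : ℕ} (ψ : Fin d → ℂ) : Matrix (Fin d) (Fin d) ℂ :=
  Matrix.of fun i j => ψ i * star (ψ j)

def ONB {m : ℕ} (ψ : Fin m → Fin m → ℂ) : Prop :=
  ∀ k l, star (ψ k) ⬝ᵥ ψ l = if k = l then 1 else 0

lemma outer_eq {d : ℕ} (ψ : Fin d → ℂ) : outer ψ = vecMulVec ψ (star ψ) := rfl

lemma onb_resolution {m : ℕ} {ψ : Fin m → Fin m → ℂ} (h : ONB ψ) :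
    ∑ k, outer (ψ k) = 1 := by
  let B : Matrix (Fin m) (Fin m) ℂ := Matrix.of fun i k => ψ k i
  have h1 : Bᴴ * B = 1 := by
    ext k l
    have := h k l
    simpa [Matrix.mul_apply, dotProduct, B, Matrix.one_apply] using this
  have h2 : B * Bᴴ = 1 := mul_eq_one_comm.mp h1
  rw [← h2]
  ext i j
  simp [Matrix.mul_apply, B, outer, Matrix.sum_apply]

lemma onb_spectral {m : ℕ} {ψ : Fin m → Fin m → ℂ} (h : ONB ψ)
    (A : Matrix (Fin m) (Fin m) ℂ) (c : Fin m → ℂ) (hc : ∀ k, A *ᵥ ψ k = c k • ψ k) :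
    A = ∑ k, c k • outer (ψ k) := by
  conv_lhs => rw [← mul_one A, ← onb_resolution h, Finset.mul_sum]
  refine Finset.sum_congr rfl fun k _ => ?_
  rw [outer_eq, mul_vecMulVec, hc, smul_vecMulVec]

lemma outer_mul_outer {m : ℕ} {ψ : Fin m → Fin m → ℂ} (h : ONB ψ) (k l : Fin m) :
    outer (ψ k) * outer (ψ l) = if k = l then outer (ψ k) else 0 := by
  rw [outer_eq, outer_eq, mul_vecMulVec, vecMulVec_mulVec, h k l]
  split_ifs with hkl
  · subst hkl; simp
  · simp

lemma diag_mul {m : ℕ} {ψ : Fin m → Fin m → ℂ} (h : ONB ψ) (a b : Fin m → ℂ) :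
    (∑ k, a k • outer (ψ k)) * (∑ k, b k • outer (ψ k)) = ∑ k, (a k * b k) • outer (ψ k) := by
  rw [Finset.sum_mul]
  refine Finset.sum_congr rfl fun k _ => ?_
  rw [Finset.mul_sum]
  simp [outer_mul_outer h, smul_smul, mul_comm]

lemma commute_of_diag {m d : ℕ} {ψ : Fin m → Fin m → ℂ} (h : ONB ψ)
    (V : Fin d → Matrix (Fin m) (Fin m) ℂ)
    (hc : ∀ j k, ∃ c : ℂ, V j *ᵥ ψ k = c • ψ k) (i j : Fin d) : V i * V j = V j * V i := by
  choose c hc using hc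
  rw [onb_spectral h (V i) (c i) (hc i), onb_spectral h (V j) (c j) (hc j),
    diag_mul h, diag_mul h]
  simp [mul_comm]

lemma diag_unitary {m : ℕ} {ψ : Fin m → Fin m → ℂ} (h : ONB ψ) (c : Fin m → ℂ)
    (hc : ∀ k, c k * star (c k) = 1) :
    (∑ k, c k • outer (ψ k)) ∈ Matrix.unitaryGroup (Fin m) ℂ := by
  rw [Matrix.mem_unitaryGroup_iff]
  have : star (∑ k, c k • outer (ψ k)) = ∑ k, star (c k) • outer (ψ k) := by
    rw [star_sum]
    refine Finset.sum_congr rfl fun k _ => ?_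
    rw [star_smul, outer_eq, Matrix.star_eq_conjTranspose, conjTranspose_vecMulVec, star_star]
  rw [this, diag_mul h]
  simp only [hc, one_smul]
  exact onb_resolution h

lemma hermitian_simul {m : ℕ} {ι : Type} (A : ι → Matrix (Fin m) (Fin m) ℂ)
    (hA : ∀ i, (A i).IsHermitian) (hcomm : ∀ i j, A i * A j = A j * A i) :
    ∃ ψ : Fin m → Fin m → ℂ, ONB ψ ∧ ∀ i k, ∃ c : ℂ, A i *ᵥ ψ k = c • ψ k := by
  classical
  let T : ι → Module.End ℂ (EuclideanSpace ℂ (Fin m)) := fun i => (A i).toEuclideanLin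
  have hT : ∀ i, (T i).IsSymmetric := fun i => isSymmetric_toEuclideanLin_iff.mpr (hA i)
  have happ : ∀ i (v : EuclideanSpace ℂ (Fin m)), (T i v).ofLp = A i *ᵥ v.ofLp := by
    intro i v; rfl
  have hC : Pairwise (Function.onFun Commute T) := by
    intro i j _
    change T i * T j = T j * T i
    refine LinearMap.ext fun v => ?_
    apply WithLp.ofLp_injective
    simp only [Module.End.mul_apply, happ, Matrix.mulVec_mulVec, hcomm i j]
  have hint := DirectSum.isInternal_ne_bot_iff.mpr
    (LinearMap.IsSymmetric.directSum_isInternal_of_pairwise_commute hT hC)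
  have horth := LinearMap.IsSymmetric.orthogonalFamily_iInf_eigenspaces hT
  have horth' := horth.comp (γ := {γ : ι → ℂ // (⨅ j, Module.End.eigenspace (T j) (γ j)) ≠ ⊥})
    Subtype.val_injective
  have : Fintype {γ : ι → ℂ // (⨅ j, Module.End.eigenspace (T j) (γ j)) ≠ ⊥} :=
    iSupIndep.fintypeNeBotOfFiniteDimensional horth.independent
  have hn : Module.finrank ℂ (EuclideanSpace ℂ (Fin m)) = m := by simp
  let b := hint.subordinateOrthonormalBasis hn horth'
  refine ⟨fun k => (b k).ofLp, ?_, ?_⟩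
  · intro k l
    have := orthonormal_iff_ite.mp b.orthonormal k l
    rw [EuclideanSpace.inner_eq_star_dotProduct, dotProduct_comm] at this
    exact this
  · intro i k
    have hk := hint.subordinateOrthonormalBasis_subordinate hn k horth'
    have hk2 := (Submodule.mem_iInf _).mp hk i
    rw [Module.End.mem_eigenspace_iff] at hk2
    have h3 := congrArg WithLp.ofLp hk2
    rw [happ] at h3
    exact ⟨_, h3⟩

lemma unitary_simul {m d : ℕ} (V : Fin d → Matrix (Fin m) (Fin m) ℂ)
    (hV : ∀ j, V j ∈ Matrix.unitaryGroup (Fin m) ℂ) (hcomm : ∀ i j, V i * V j = V j * V i) :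
    ∃ ψ : Fin m → Fin m → ℂ, ONB ψ ∧ ∀ i k, ∃ c : ℂ, V i *ᵥ ψ k = c • ψ k := by
  have h1 : ∀ i j, Commute (V i) (V j) := hcomm
  have h2 : ∀ i j, Commute (V i) (V j)ᴴ := by
    intro i j
    have e1 : V j * (V j)ᴴ = 1 := Matrix.mem_unitaryGroup_iff.mp (hV j)
    have e2 : (V j)ᴴ * V j = 1 := Matrix.mem_unitaryGroup_iff'.mp (hV j)
    change V i * (V j)ᴴ = (V j)ᴴ * V i
    calc V i * (V j)ᴴ = (V j)ᴴ * V j * (V i * (V j)ᴴ) := by rw [e2, one_mul]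
      _ = (V j)ᴴ * (V j * V i) * (V j)ᴴ := by simp only [mul_assoc]
      _ = (V j)ᴴ * V i * (V j * (V j)ᴴ) := by rw [hcomm j i]; simp only [mul_assoc]
      _ = _ := by rw [e1, mul_one]
  have h3 : ∀ i j, Commute (V i)ᴴ (V j) := fun i j => (h2 j i).symm
  have h4 : ∀ i j, Commute (V i)ᴴ (V j)ᴴ := by
    intro i j
    change (V i)ᴴ * (V j)ᴴ = (V j)ᴴ * (V i)ᴴ
    rw [← conjTranspose_mul, ← conjTranspose_mul, hcomm]
  let A : Fin d ⊕ Fin d → Matrix (Fin m) (Fin m) ℂ :=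
    Sum.elim (fun i => V i + (V i)ᴴ) (fun i => Complex.I • (V i - (V i)ᴴ))
  obtain ⟨ψ, hψ, hc⟩ := hermitian_simul A
    (by
      rintro (i | i)
      · simp [A, Matrix.IsHermitian, add_comm]
      · simp [A, Matrix.IsHermitian, conjTranspose_smul]
        rw [← smul_neg, neg_sub])
    (by
      have s1 : ∀ i j, Commute (V i + (V i)ᴴ) (V j + (V j)ᴴ) := fun i j =>
        ((h1 i j).add_right (h2 i j)).add_left ((h3 i j).add_right (h4 i j))
      have s2 : ∀ i j, Commute (V i + (V i)ᴴ) (V j - (V j)ᴴ) := fun i j =>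
        ((h1 i j).sub_right (h2 i j)).add_left ((h3 i j).sub_right (h4 i j))
      have s3 : ∀ i j, Commute (V i - (V i)ᴴ) (V j - (V j)ᴴ) := fun i j =>
        ((h1 i j).sub_right (h2 i j)).sub_left ((h3 i j).sub_right (h4 i j))
      rintro (i | i) (j | j)
      · exact s1 i j
      · exact (s2 i j).smul_right _
      · exact ((s2 j i).smul_right _).symm
      · exact ((s3 i j).smul_right _).smul_left _)
  refine ⟨ψ, hψ, fun i k => ?_⟩
  obtain ⟨a, ha⟩ := hc (Sum.inl i) k
  obtain ⟨b, hb⟩ := hc (Sum.inr i) k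
  refine ⟨(1/2 : ℂ) * (a - Complex.I * b), ?_⟩
  have e : V i = (1/2 : ℂ) • (A (Sum.inl i) - Complex.I • A (Sum.inr i)) := by
    simp only [A, Sum.elim_inl, Sum.elim_inr, smul_smul, Complex.I_mul_I]
    ext x y
    simp
    ring
  rw [e, smul_mulVec, sub_mulVec, smul_mulVec, ha, hb]
  module

lemma eigen_phase {m : ℕ} (V : Matrix (Fin m) (Fin m) ℂ) (hV : V ∈ Matrix.unitaryGroup (Fin m) ℂ)
    (v : Fin m → ℂ) (hv : star v ⬝ᵥ v = 1) (c : ℂ) (hc : V *ᵥ v = c • v) : c * star c = 1 := by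
  have e2 : Vᴴ * V = 1 := Matrix.mem_unitaryGroup_iff'.mp hV
  have : star (V *ᵥ v) ⬝ᵥ (V *ᵥ v) = 1 := by
    rw [star_mulVec, ← dotProduct_mulVec, mulVec_mulVec, e2, one_mulVec, hv]
  rw [hc, star_smul, smul_dotProduct, dotProduct_smul, hv] at this
  simpa [mul_comm] using this

lemma kron_vec {d m : ℕ} (A : Matrix (Fin d) (Fin d) ℂ) (B : Matrix (Fin m) (Fin m) ℂ)
    (x : Fin d → ℂ) (y : Fin m → ℂ) :
    (A ⊗ₖ B) *ᵥ vecTensor x y = vecTensor (A *ᵥ x) (B *ᵥ y) := by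
  ext ⟨i, j⟩
  simp only [mulVec, dotProduct, vecTensor, kroneckerMap_apply, Fintype.sum_prod_type,
    Finset.sum_mul_sum]
  refine Finset.sum_congr rfl fun _ _ => Finset.sum_congr rfl fun _ _ => ?_
  ring

lemma outer_vec {m : ℕ} {ψ : Fin m → Fin m → ℂ} (h : ONB ψ) (k l : Fin m) :
    outer (ψ k) *ᵥ ψ l = if k = l then ψ l else 0 := by
  rw [outer_eq, vecMulVec_mulVec, h k l]
  split_ifs with hkl
  · subst hkl; simp
  · simp

lemma vecTensor_zero_left {d m : ℕ} (y : Fin m → ℂ) : vecTensor (0 : Fin d → ℂ) y = 0 := by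
  ext; simp [vecTensor]

lemma vecTensor_zero_right {d m : ℕ} (x : Fin d → ℂ) : vecTensor x (0 : Fin m → ℂ) = 0 := by
  ext; simp [vecTensor]

lemma vecTensor_smul_right {d m : ℕ} (c : ℂ) (x : Fin d → ℂ) (y : Fin m → ℂ) :
    vecTensor x (c • y) = c • vecTensor x y := by
  ext; simp [vecTensor]; ring

lemma vecTensor_smul_left {d m : ℕ} (c : ℂ) (x : Fin d → ℂ) (y : Fin m → ℂ) :
    vecTensor (c • x) y = c • vecTensor x y := by
  ext; simp [vecTensor]; ring

lemma ctrl_vec {d m : ℕ} {φ : Fin d → Fin d → ℂ} (h : ONB φ)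
    (V : Fin d → Matrix (Fin m) (Fin m) ℂ) (j : Fin d) (y : Fin m → ℂ) :
    (∑ i, outer (φ i) ⊗ₖ V i) *ᵥ vecTensor (φ j) y = vecTensor (φ j) (V j *ᵥ y) := by
  rw [sum_mulVec, Finset.sum_eq_single j]
  · simp [kron_vec, outer_vec h]
  · intro i _ hij
    simp [kron_vec, outer_vec h, hij, vecTensor_zero_left]
  · simp

lemma ctrl_vec' {d m : ℕ} {ψ : Fin m → Fin m → ℂ} (h : ONB ψ)
    (W : Fin m → Matrix (Fin d) (Fin d) ℂ) (k : Fin m) (x : Fin d → ℂ) :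
    (∑ i, W i ⊗ₖ outer (ψ i)) *ᵥ vecTensor x (ψ k) = vecTensor (W k *ᵥ x) (ψ k) := by
  rw [sum_mulVec, Finset.sum_eq_single k]
  · simp [kron_vec, outer_vec h]
  · intro i _ hij
    simp [kron_vec, outer_vec h, hij, vecTensor_zero_right]
  · simp

lemma contract {d m : ℕ} (x x' : Fin d → ℂ) (y y' : Fin m → ℂ) (hx : star x ⬝ᵥ x = 1)
    (h : vecTensor x y = vecTensor x' y') : y = (star x ⬝ᵥ x') • y' := by
  ext b
  have e : ∀ a, x a * y b = x' a * y' b := fun a => congrFun h (a, b)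
  calc y b = (star x ⬝ᵥ x) * y b := by rw [hx, one_mul]
    _ = ∑ a, star x a * (x a * y b) := by simp [dotProduct, Finset.sum_mul, mul_assoc]
    _ = _ := by simp [e, dotProduct, Finset.sum_mul, mul_assoc]

/-- For a controlled unitary `U = Σ_j |φ_j⟩⟨φ_j| ⊗ V_j` the following are equivalent:
(i) the `V_j` pairwise commute; (ii) `U = Σ_k U_k ⊗ |ψ_k⟩⟨ψ_k|` for some orthonormal
basis `{ψ_k}` and unitaries `U_k`; (iii) `U(φ_j ⊗ ψ_k) = e^{iη_{jk}} φ_j ⊗ ψ_k` for some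
orthonormal basis `{ψ_k}` and phases `η_{jk}` — i.e. `U` generates simultaneous
decoherence of both systems. -/
theorem stmt12 {d m : ℕ} (φ : Fin d → Fin d → ℂ)
    (horth : ∀ j k, star (φ j) ⬝ᵥ φ k = if j = k then 1 else 0)
    (V : Fin d → Matrix (Fin m) (Fin m) ℂ)
    (hV : ∀ j, V j ∈ Matrix.unitaryGroup (Fin m) ℂ)
    (U : Matrix (Fin d × Fin m) (Fin d × Fin m) ℂ)
    (hU : U = ∑ j, outer (φ j) ⊗ₖ V j) :
    ((∀ j k, V j * V k = V k * V j) ↔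
      (∃ ψ : Fin m → Fin m → ℂ,
        (∀ k l, star (ψ k) ⬝ᵥ ψ l = if k = l then 1 else 0) ∧
        ∃ Uc : Fin m → Matrix (Fin d) (Fin d) ℂ,
          (∀ k, Uc k ∈ Matrix.unitaryGroup (Fin d) ℂ) ∧
          U = ∑ k, Uc k ⊗ₖ outer (ψ k))) ∧
    ((∀ j k, V j * V k = V k * V j) ↔
      (∃ ψ : Fin m → Fin m → ℂ,
        (∀ k l, star (ψ k) ⬝ᵥ ψ l = if k = l then 1 else 0) ∧
        ∃ ηp : Fin d → Fin m → ℝ, ∀ j k,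
          U.mulVec (vecTensor (φ j) (ψ k))
            = Complex.exp (Complex.I * (ηp j k : ℂ)) • vecTensor (φ j) (ψ k))) := by
  have hφ : ONB φ := horth
  have fwd : (∀ j k, V j * V k = V k * V j) → ∃ ψ : Fin m → Fin m → ℂ, ONB ψ ∧
      ∃ c : Fin d → Fin m → ℂ, (∀ j k, V j *ᵥ ψ k = c j k • ψ k) ∧
        ∀ j k, c j k * star (c j k) = 1 := by
    intro hcomm
    obtain ⟨ψ, hψ, hc⟩ := unitary_simul V hV hcomm
    choose c hc using hc
    exact ⟨ψ, hψ, c, hc, fun j k => eigen_phase (V j) (hV j) (ψ k)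
      (by simpa using hψ k k) (c j k) (hc j k)⟩
  have hone : ∀ j, star (φ j) ⬝ᵥ φ j = 1 := fun j => by simpa using horth j j
  refine ⟨⟨?_, ?_⟩, ⟨?_, ?_⟩⟩
  · intro hcomm
    obtain ⟨ψ, hψ, c, hc, hc1⟩ := fwd hcomm
    refine ⟨ψ, hψ, fun k => ∑ j, c j k • outer (φ j),
      fun k => diag_unitary hφ (fun j => c j k) (fun j => hc1 j k), ?_⟩
    rw [hU]
    have e : ∀ j, V j = ∑ k, c j k • outer (ψ k) := fun j => onb_spectral hψ _ _ (hc j)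
    ext ⟨a, b⟩ ⟨a', b'⟩
    simp only [Matrix.sum_apply, kroneckerMap_apply, e, Matrix.smul_apply, smul_eq_mul,
      Finset.mul_sum, Finset.sum_mul]
    rw [Finset.sum_comm]
    refine Finset.sum_congr rfl fun _ _ => Finset.sum_congr rfl fun _ _ => ?_
    ring
  · rintro ⟨ψ, hψ, W, -, hW⟩
    refine commute_of_diag hψ V fun j k => ?_
    have := ctrl_vec hφ V j (ψ k)
    rw [← hU, hW, ctrl_vec' hψ] at this
    exact ⟨_, contract _ _ _ _ (hone j) this.symm⟩
  · intro hcomm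
    obtain ⟨ψ, hψ, c, hc, hc1⟩ := fwd hcomm
    refine ⟨ψ, hψ, fun j k => Complex.arg (c j k), fun j k => ?_⟩
    have hn : ‖c j k‖ = 1 := by
      have h := congrArg norm (hc1 j k)
      rw [norm_mul, norm_star, norm_one] at h
      nlinarith [norm_nonneg (c j k)]
    have h2 := Complex.norm_mul_exp_arg_mul_I (c j k)
    rw [hn, Complex.ofReal_one, one_mul, mul_comm] at h2
    rw [h2, hU, ctrl_vec hφ, hc, vecTensor_smul_right]
  · rintro ⟨ψ, hψ, η, hη⟩
    refine commute_of_diag hψ V fun j k => ?_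
    have := hη j k
    rw [hU, ctrl_vec hφ, ← vecTensor_smul_left] at this
    exact ⟨_, contract _ _ _ _ (hone j) this⟩
end
end

section
/- Let N ≥ 2 and let Ψ = α₀|0⟩^{⊗N} + Σ_{j=1}^N α_j |e_j⟩ be a unit vector in (ℂ²)^{⊗N}, where |e_j⟩ denotes the computational basis vector with a 1 in position j and 0 elsewhere, and |α₀|² + Σ_j |α_j|² = 1. Let ρ_j be the single-qubit reduced density matrix of |Ψ⟩⟨Ψ| on qubit j. Then det ρ_j = |α_j|² · Σ_{k≠j} |α_k|² = Σ_{k≠j} |α_j|²|α_k|². (Since the one-tangle is τ_j = 4 det ρ_j and the pair tangle of qubits j,k equals τ_{jk} = 4|α_j|²|α_k|², this says that all states of this W-type form saturate the Coffman–Kundu–Wootters monogamy inequality: τ_j = Σ_{k≠j} τ_{jk}.) -/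
open Matrix Complex BigOperators

noncomputable section

/-- Extend a configuration of all qubits except `j` by the value `a` at qubit `j`. -/
def insertAt {N : ℕ} (j : Fin N) (a : Fin 2)
    (f : {k : Fin N // k ≠ j} → Fin 2) : Fin N → Fin 2 :=
  fun k => if h : k = j then a else f ⟨k, h⟩

/-- The single-qubit reduced density matrix of the pure state `Ψ` on qubit `j`. -/
def rdm {N : ℕ} (Ψ : (Fin N → Fin 2) → ℂ) (j : Fin N) : Matrix (Fin 2) (Fin 2) ℂ :=
  Matrix.of fun a b =>
    ∑ f : {k : Fin N // k ≠ j} → Fin 2, Ψ (insertAt j a f) * star (Ψ (insertAt j b f))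

/-- The W-type state `Ψ = α₀|0⟩^{⊗N} + Σ_j α_j |e_j⟩`, where `|e_j⟩` is the computational
basis vector with a `1` in position `j` and `0` elsewhere. -/
def wState {N : ℕ} (α₀ : ℂ) (α : Fin N → ℂ) : (Fin N → Fin 2) → ℂ :=
  fun v => (if v = fun _ => 0 then α₀ else 0)
    + ∑ j, if v = Function.update (fun _ => (0 : Fin 2)) j 1 then α j else 0

theorem w_one {N : ℕ} (α₀ : ℂ) (α : Fin N → ℂ) (j : Fin N) (f : {k : Fin N // k ≠ j} → Fin 2) :
    wState α₀ α (insertAt j 1 f) = if f = (fun _ => 0) then α j else 0 := by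
  unfold wState
  have h0 : ¬ (insertAt j 1 f = fun _ => 0) := by
    intro h
    have := congrFun h j
    simp [insertAt] at this
  rw [if_neg h0, zero_add, Finset.sum_eq_single j]
  · congr 1
    apply propext
    constructor
    · intro h
      funext k
      have := congrFun h k.1
      simpa [insertAt, k.2] using this
    · rintro rfl
      funext k
      by_cases hk : k = j
      · subst hk; simp [insertAt]
      · simp [insertAt, hk]
  · intro k _ hk
    rw [if_neg]
    intro h
    have := congrFun h j
    simp [insertAt, Function.update_of_ne (Ne.symm hk)] at this
  · simp

/-- index configurations -/
def gOpt {N : ℕ} (j : Fin N) : Option {k : Fin N // k ≠ j} → ({k : Fin N // k ≠ j} → Fin 2)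
  | none => fun _ => 0
  | some k => Function.update (fun _ => 0) k 1

/-- coefficients -/
def cOpt {N : ℕ} (α₀ : ℂ) (α : Fin N → ℂ) (j : Fin N) : Option {k : Fin N // k ≠ j} → ℂ
  | none => α₀
  | some k => α k.1

theorem gOpt_inj {N : ℕ} (j : Fin N) : Function.Injective (gOpt j) := by
  rintro (_ | a) (_ | b) h
  · rfl
  · have := congrFun h b
    simp [gOpt] at this
  · have := congrFun h a
    simp [gOpt] at this
  · by_contra hab
    have := congrFun h a
    have hne : a ≠ b := fun e => hab (by rw [e])
    simp [gOpt, Function.update_of_ne hne] at this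

theorem w_zero {N : ℕ} (α₀ : ℂ) (α : Fin N → ℂ) (j : Fin N) (f : {k : Fin N // k ≠ j} → Fin 2) :
    wState α₀ α (insertAt j 0 f) = ∑ o, if f = gOpt j o then cOpt α₀ α j o else 0 := by
  rw [Fintype.sum_option]
  unfold wState
  congr 1
  · show _ = if f = (fun _ => 0) then α₀ else 0
    congr 1
    apply propext
    constructor
    · intro h
      funext k
      have := congrFun h k.1
      simpa [insertAt, k.2] using this
    · rintro rfl
      funext k
      by_cases hk : k = j <;> simp [insertAt, hk]
  · have hj : (if insertAt j 0 f = Function.update (fun _ => (0 : Fin 2)) j 1 then α j else 0)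
        = 0 := by
      rw [if_neg]
      intro h
      have := congrFun h j
      simp [insertAt] at this
    rw [← Finset.sum_erase (f := fun k => if insertAt j 0 f =
      Function.update (fun _ => (0 : Fin 2)) k 1 then α k else 0) (a := j) Finset.univ hj,
      ← Finset.sum_subtype_of_mem (p := fun k => k ≠ j) _ (by simp)]
    have hu : Finset.subtype (fun k => k ≠ j) (Finset.univ.erase j) = Finset.univ := by
      ext k; simp [k.2]
    rw [hu]
    refine Finset.sum_congr rfl fun k _ => ?_
    show _ = if f = Function.update (fun _ => 0) k 1 then α k.1 else 0
    congr 1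
    apply propext
    constructor
    · intro h
      funext l
      have := congrFun h l.1
      simpa [insertAt, l.2, Function.update_apply, Subtype.ext_iff] using this
    · rintro rfl
      funext l
      by_cases hl : l = j
      · subst hl; simp [insertAt, Function.update_of_ne (Ne.symm k.2)]
      · simp [insertAt, hl, Function.update_apply, Subtype.ext_iff]

theorem w_zero_g {N : ℕ} (α₀ : ℂ) (α : Fin N → ℂ) (j : Fin N) (o : Option {k : Fin N // k ≠ j}) :
    wState α₀ α (insertAt j 0 (gOpt j o)) = cOpt α₀ α j o := by
  rw [w_zero]
  simp [(gOpt_inj j).eq_iff]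

theorem rdm00 {N : ℕ} (α₀ : ℂ) (α : Fin N → ℂ) (j : Fin N) :
    rdm (wState α₀ α) j 0 0 = α₀ * star α₀ + ∑ k ∈ Finset.univ.erase j, α k * star (α k) := by
  have h1 : rdm (wState α₀ α) j 0 0 = ∑ f : {k : Fin N // k ≠ j} → Fin 2, 
      ∑ o, if f = gOpt j o then cOpt α₀ α j o * star (cOpt α₀ α j o) else 0 := by
    unfold rdm
    refine Finset.sum_congr rfl fun f _ => ?_
    nth_rw 1 [w_zero]
    rw [Finset.sum_mul]
    refine Finset.sum_congr rfl fun o _ => ?_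
    split_ifs with h
    · rw [h, w_zero_g]
    · simp
  rw [h1, Finset.sum_comm]
  simp only [Finset.sum_ite_eq', Finset.sum_ite_eq, Finset.mem_univ, if_true]
  rw [Fintype.sum_option]
  congr 1
  rw [← Finset.sum_subtype_of_mem (p := fun k => k ≠ j) (fun k => α k * star (α k)) (by simp)]
  have hu : Finset.subtype (fun k => k ≠ j) (Finset.univ.erase j) = Finset.univ := by
    ext k; simp [k.2]
  rw [hu]
  rfl

/-- For the W-type state, `det ρ_j = |α_j|² Σ_{k≠j} |α_k|²`; hence these states saturate
the CKW monogamy inequality `τ_j = Σ_{k≠j} τ_{jk}`. -/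
theorem stmt13 {N : ℕ} (hN : 2 ≤ N) (α₀ : ℂ) (α : Fin N → ℂ)
    (hnorm : ‖α₀‖ ^ 2 + ∑ j, ‖α j‖ ^ 2 = 1) (j : Fin N) :
    (rdm (wState α₀ α) j).det
      = ((‖α j‖ ^ 2 * ∑ k ∈ Finset.univ.erase j, ‖α k‖ ^ 2 : ℝ) : ℂ) := by
  have hz : wState α₀ α (insertAt j 0 fun _ => 0) = α₀ := w_zero_g α₀ α j none
  have h11 : rdm (wState α₀ α) j 1 1 = α j * star (α j) := by
    simp [rdm, w_one]
  have h01 : rdm (wState α₀ α) j 0 1 = α₀ * star (α j) := by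
    simp [rdm, w_one, apply_ite, hz]
  have h10 : rdm (wState α₀ α) j 1 0 = α j * star α₀ := by
    simp [rdm, w_one, hz]
  have hs : ∀ z : ℂ, z * star z = ((‖z‖ ^ 2 : ℝ) : ℂ) := by
    intro z
    simpa using Complex.mul_conj' z
  rw [Matrix.det_fin_two, rdm00, h11, h01, h10]
  push_cast
  have h2 : ∑ k ∈ Finset.univ.erase j, α k * star (α k)
      = ∑ k ∈ Finset.univ.erase j, ((‖α k‖ : ℂ) ^ 2) :=
    Finset.sum_congr rfl fun k _ => by rw [hs]; push_cast; rfl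
  have h3 := hs (α j)
  push_cast at h3
  rw [← h2, ← h3]
  ring
end
end

section
/- Let Γ₁, Γ₂, Ω, w be real numbers, and for t ∈ ℝ, t ≥ 0, let E_t be the real 4×4 matrix with rows (1,0,0,0), (0, e^{−Γ₂t} cos Ωt, e^{−Γ₂t} sin Ωt, 0), (0, −e^{−Γ₂t} sin Ωt, e^{−Γ₂t} cos Ωt, 0), (w(1−e^{−Γ₁t}), 0, 0, e^{−Γ₁t}). Then E₀ = I and E_t · E_s = E_{t+s} for all t, s ≥ 0; i.e., the family {E_t}_{t≥0} is a one-parametric semigroup of affine Bloch transformations, which interpolates the discrete collision dynamics E^n of the homogenization model at times t = nτ under the identifications c^{2t/τ} = e^{−Γ₁t}, (cq)^{t/τ} = e^{−Γ₂t}, Ω = θ/τ. -/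
open Matrix BigOperators

noncomputable section

/-- The continuous-time Bloch-affine family interpolating the homogenization
collision dynamics. -/
def Ebloch (Γ₁ Γ₂ Ω w : ℝ) (t : ℝ) : Matrix (Fin 4) (Fin 4) ℝ :=
  !![(1 : ℝ), 0, 0, 0;
     0, Real.exp (-Γ₂ * t) * Real.cos (Ω * t), Real.exp (-Γ₂ * t) * Real.sin (Ω * t), 0;
     0, -(Real.exp (-Γ₂ * t) * Real.sin (Ω * t)), Real.exp (-Γ₂ * t) * Real.cos (Ω * t), 0;
     w * (1 - Real.exp (-Γ₁ * t)), 0, 0, Real.exp (-Γ₁ * t)]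

/-- `{E_t}_{t≥0}` is a one-parametric semigroup of affine Bloch transformations
(`E₀ = I`, `E_t E_s = E_{t+s}`), and under the identifications
`e^{−Γ₁τ} = c²`, `e^{−Γ₂τ} = cq`, `Ω = θ/τ` it interpolates the discrete collision
dynamics: `E_{nτ} = M^n` with `M` the one-step Bloch matrix of the homogenization
channel. -/
theorem stmt19 (Γ₁ Γ₂ Ω w : ℝ) :
    Ebloch Γ₁ Γ₂ Ω w 0 = 1 ∧
    (∀ t s : ℝ, 0 ≤ t → 0 ≤ s →
      Ebloch Γ₁ Γ₂ Ω w t * Ebloch Γ₁ Γ₂ Ω w s = Ebloch Γ₁ Γ₂ Ω w (t + s)) ∧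
    (∀ τ c q θ : ℝ, 0 < τ →
      Real.exp (-Γ₁ * τ) = c ^ 2 → Real.exp (-Γ₂ * τ) = c * q → Ω = θ / τ →
      ∀ n : ℕ, Ebloch Γ₁ Γ₂ Ω w (n * τ)
        = (!![(1 : ℝ), 0, 0, 0;
              0, c * q * Real.cos θ, c * q * Real.sin θ, 0;
              0, -(c * q * Real.sin θ), c * q * Real.cos θ, 0;
              w * (1 - c ^ 2), 0, 0, c ^ 2] : Matrix (Fin 4) (Fin 4) ℝ) ^ n) := by
  have mul : ∀ t s : ℝ, Ebloch Γ₁ Γ₂ Ω w t * Ebloch Γ₁ Γ₂ Ω w s = Ebloch Γ₁ Γ₂ Ω w (t + s) := by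
    intro t s
    ext i j
    fin_cases i <;> fin_cases j <;>
      simp [Ebloch, Matrix.mul_apply, Fin.sum_univ_four, mul_add, Real.exp_add, Real.cos_add,
        Real.sin_add] <;> ring
  have zero : Ebloch Γ₁ Γ₂ Ω w 0 = 1 := by
    ext i j
    fin_cases i <;> fin_cases j <;> simp [Ebloch]
  refine ⟨zero, fun t s _ _ => mul t s, ?_⟩
  intro τ c q θ hτ h1 h2 hΩ n
  have hθ : Ω * τ = θ := by rw [hΩ]; field_simp
  have step : Ebloch Γ₁ Γ₂ Ω w τ = !![(1 : ℝ), 0, 0, 0;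
              0, c * q * Real.cos θ, c * q * Real.sin θ, 0;
              0, -(c * q * Real.sin θ), c * q * Real.cos θ, 0;
              w * (1 - c ^ 2), 0, 0, c ^ 2] := by
    rw [Ebloch, h1, h2, hθ]
  rw [← step]
  induction n with
  | zero => simpa using zero
  | succ k ih =>
    rw [pow_succ, ← ih, mul]
    congr 1
    push_cast
    ring
end
end
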